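/- Let β ∈ (0, 1/2^{|S|}), a > 0 and ε ∈ (0, (1/2)·(a/L)^{|S|}·β(1−β)/(L·|S|⁴)). Let q be an irreducible transition matrix on S with stationary distribution μ, satisfying the mixing hypothesis with parameter a on S₁, and let q̂ be a transition matrix that is (ε,β)-close to q on S₁ and coincides with q on S\S₁. Let R be a recurrent class for q̂ containing S₁ and μ̂ the unique stationary distribution of q̂ supported on R. For a nonempty proper subset C of S₁, define K_C = μ_C / (Σ_{s∈C} μ_s q(C̄|s)) and K̂_C = μ̂_C / (Σ_{s∈C} μ̂_s q̂(C̄|s)). Then K_C/(2|S|²) ≤ K̂_C ≤ 2|S|²·K_C. -/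

import Mathlib

open Finset

namespace PerturbedMC

variable {S : Type*} [Fintype S] [DecidableEq S]

/-- `q` is a (row-stochastic) transition matrix on `S`: `q s t` is the probability of moving
from `s` to `t`. -/
def IsTransition (q : Matrix S S ℝ) : Prop :=
  (∀ s t, 0 ≤ q s t) ∧ ∀ s, ∑ t, q s t = 1

/-- `q` is irreducible. -/
def IsIrreducible (q : Matrix S S ℝ) : Prop :=
  ∀ s t, ∃ n : ℕ, 1 ≤ n ∧ 0 < (q ^ n) s t

/-- `μ` is a stationary distribution of `q`. -/
def IsStationary (q : Matrix S S ℝ) (μ : S → ℝ) : Prop :=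
  (∀ s, 0 ≤ μ s) ∧ (∑ s, μ s = 1) ∧ ∀ t, ∑ s, μ s * q s t = μ t

/-- The combinatorial constant `L = ∑_{n=1}^{|S|-1} C(|S|,n) · n^{|S|}`. -/
def Lconst (S : Type*) [Fintype S] : ℕ :=
  ∑ n ∈ Finset.Ico 1 (Fintype.card S), (Fintype.card S).choose n * n ^ Fintype.card S

/-- `ζ_q`: the minimal stationary outflow over nonempty proper subsets of `S`. -/
noncomputable def zeta (q : Matrix S S ℝ) (μ : S → ℝ) : ℝ :=
  sInf {x : ℝ | ∃ C : Finset S, C.Nonempty ∧ C ≠ Finset.univ ∧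
    x = ∑ s ∈ C, μ s * ∑ t ∈ Cᶜ, q s t}

/-- `ζ_q^1`: the minimal stationary outflow over nonempty proper subsets of `S₁`. -/
noncomputable def zeta1 (q : Matrix S S ℝ) (μ : S → ℝ) (S1 : Finset S) : ℝ :=
  sInf {x : ℝ | ∃ C : Finset S, C.Nonempty ∧ C ⊂ S1 ∧
    x = ∑ s ∈ C, μ s * ∑ t ∈ Cᶜ, q s t}

/-- `q̂` is `(ε,β)`-close to `q`, relative to the threshold `z` (`z = ζ_q` or `z = ζ_q^1`):
`|q̂(t|s) − q(t|s)| ≤ β·q(t|s)` whenever `μ_s q(t|s) ≥ ε·z` or `μ_s q̂(t|s) ≥ ε·z`. -/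
def IsClose (q qh : Matrix S S ℝ) (μ : S → ℝ) (z ε β : ℝ) : Prop :=
  ∀ s t, (ε * z ≤ μ s * q s t ∨ ε * z ≤ μ s * qh s t) → |qh s t - q s t| ≤ β * q s t

/-- The substochastic `C × C` restriction `q_C` of `q`. -/
def subMat (q : Matrix S S ℝ) (C : Finset S) : Matrix S S ℝ :=
  fun u v => if u ∈ C ∧ v ∈ C then q u v else 0

/-- The exit distribution `Q_{s,q}(t|C) = Σ_{n≥0} Σ_{u∈C} (q_C^n)(u|s)·q(t|u)`. -/
noncomputable def exitProb (q : Matrix S S ℝ) (C : Finset S) (s t : S) : ℝ :=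
  ∑' n : ℕ, ∑ u ∈ C, ((subMat q C ^ n : Matrix S S ℝ) s u) * q u t

/-- The expected exit time `E_{s,q}[T_{C̄}] = Σ_{n≥0} Σ_{u∈C} (q_C^n)(u|s) ∈ [0,∞]`. -/
noncomputable def expExit (q : Matrix S S ℝ) (C : Finset S) (s : S) : ENNReal :=
  ∑' n : ℕ, ENNReal.ofReal (∑ u ∈ C, (subMat q C ^ n : Matrix S S ℝ) s u)

/-- `g` has a cycle within `C`. -/
def HasCycle (C : Finset S) (g : S → S) : Prop :=
  ∃ (k : ℕ) (f : ℕ → S), 0 < k ∧ f k = f 0 ∧ (∀ i < k, f i ∈ C) ∧ ∀ i < k, g (f i) = f (i + 1)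

/-- `g` is a `C`-graph (the values of `g` outside `C` are irrelevant). -/
def IsCGraph (C : Finset S) (g : S → S) : Prop := ¬ HasCycle C g

/-- `s` leads to `t` along `g`: `t` is the first state outside `C` on the `g`-orbit of `s`. -/
def LeadsTo (C : Finset S) (g : S → S) (s t : S) : Prop :=
  ∃ n : ℕ, g^[n] s = t ∧ t ∉ C ∧ ∀ m < n, g^[m] s ∈ C

/-- The weight `p(g) = Π_{s∈C} q(g(s)|s)` of a `C`-graph under `q`. -/
def wt (q : Matrix S S ℝ) (C : Finset S) (g : S → S) : ℝ := ∏ s ∈ C, q s (g s)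

/-- `G(C)`: the canonical representatives of `C`-graphs, namely the maps `S → S` that are
`C`-graphs and are the identity outside `C`. -/
noncomputable def Gset (C : Finset S) : Finset (S → S) :=
  @Finset.filter _ (fun g => IsCGraph C g ∧ ∀ s ∉ C, g s = s) (Classical.decPred _) Finset.univ

/-- `G_{s,t}(C)`: the `C`-graphs along which `s` leads to `t`. -/
noncomputable def GsetLead (C : Finset S) (s t : S) : Finset (S → S) :=
  @Finset.filter _ (fun g => LeadsTo C g s t) (Classical.decPred _) (Gset C)

/-- `g` is an `η`-maximal `C`-graph under `q`: `p(g) ≥ η · max_{g' ∈ G(C)} p(g')`. -/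
def IsMaximal (q : Matrix S S ℝ) (C : Finset S) (η : ℝ) (g : S → S) : Prop :=
  IsCGraph C g ∧ ∀ g', IsCGraph C g' → η * wt q C g' ≤ wt q C g

/-- `H = G^β(C) ∪ Ĝ^β(C)` as a finset of canonical representatives. -/
noncomputable def Hset (q qh : Matrix S S ℝ) (C : Finset S) (β : ℝ) : Finset (S → S) :=
  @Finset.filter _ (fun g => IsMaximal q C β g ∨ IsMaximal qh C β g)
    (Classical.decPred _) (Gset C)

/-- The mixing hypothesis with parameter `a` on `S₁`: for all `s,t ∈ S₁`, the probability
that the chain started at `s`, from its first step onward, reaches `t` before reaching any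
state of `S \ S₁`, is at least `a`. -/
def Mixing (q : Matrix S S ℝ) (S1 : Finset S) (a : ℝ) : Prop :=
  ∀ s ∈ S1, ∀ t ∈ S1,
    a ≤ q s t + ∑ u ∈ S1.erase t, q s u * exitProb q (S1.erase t) u t

/-- `R` is a recurrent class for `q`. -/
def IsRecClass (q : Matrix S S ℝ) (R : Finset S) : Prop :=
  (∀ s ∈ R, ∑ t ∈ Rᶜ, q s t = 0) ∧
    ∀ s ∈ R, ∀ t ∈ R, ∃ n : ℕ, 1 ≤ n ∧ 0 < (q ^ n) s t

lemma IsStationary.sum_mul_pow {q : Matrix S S ℝ} {μ : S → ℝ} (hμ : IsStationary q μ) (n : ℕ)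
    (t : S) : ∑ s, μ s * (q ^ n) s t = μ t := by
  induction n generalizing t with
  | zero => simp [Matrix.one_apply]
  | succ n ih =>
    simp only [pow_succ, Matrix.mul_apply, Finset.mul_sum]
    rw [Finset.sum_comm]
    simp only [← mul_assoc, ← Finset.sum_mul, ih]
    exact hμ.2.2 t

lemma IsTransition.pow_nonneg {q : Matrix S S ℝ} (hq : IsTransition q) (n : ℕ) (s t : S) :
    0 ≤ (q ^ n) s t := by
  induction n generalizing t with
  | zero => rw [pow_zero, Matrix.one_apply]; positivity
  | succ n ih =>
    rw [pow_succ, Matrix.mul_apply]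
    exact Finset.sum_nonneg fun u _ => mul_nonneg (ih u) (hq.1 u t)

lemma IsStationary.pos_of_reachable {q : Matrix S S ℝ} {μ : S → ℝ} (hq : IsTransition q)
    (hμ : IsStationary q μ) {R : Finset S} (hsupp : ∀ s ∉ R, μ s = 0)
    (hR : ∀ s ∈ R, ∀ t ∈ R, ∃ n : ℕ, 1 ≤ n ∧ 0 < (q ^ n) s t) {t : S} (ht : t ∈ R) :
    0 < μ t := by
  obtain ⟨s, hs⟩ : ∃ s, μ s ≠ 0 := by
    by_contra! h
    have := hμ.2.1
    simp [h] at this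
  have hsR : s ∈ R := by
    by_contra h
    exact hs (hsupp s h)
  obtain ⟨n, -, hn⟩ := hR s hsR t ht
  rw [← hμ.sum_mul_pow n t]
  exact Finset.sum_pos' (fun u _ => mul_nonneg (hμ.1 u) (hq.pow_nonneg n u t))
    ⟨s, Finset.mem_univ s, mul_pos ((hμ.1 s).lt_of_ne' hs) hn⟩

/-- In an irreducible chain every nonempty proper set has positive stationary outflow. -/
lemma outflow_pos {q : Matrix S S ℝ} {μ : S → ℝ} (hq : IsTransition q) (hirr : IsIrreducible q)
    (hμ : ∀ s, 0 < μ s) {C : Finset S} (hC : C.Nonempty) (hC' : Cᶜ.Nonempty) :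
    0 < ∑ s ∈ C, μ s * ∑ t ∈ Cᶜ, q s t := by
  have hnn : ∀ s ∈ C, 0 ≤ μ s * ∑ t ∈ Cᶜ, q s t := fun s _ =>
    mul_nonneg (hμ s).le (Finset.sum_nonneg fun t _ => hq.1 s t)
  refine (Finset.sum_nonneg hnn).lt_of_ne' fun h0 => ?_
  have hzero : ∀ s ∈ C, ∀ t ∈ Cᶜ, q s t = 0 := by
    intro s hs
    have h1 := (Finset.sum_eq_zero_iff_of_nonneg hnn).1 h0 s hs
    exact (Finset.sum_eq_zero_iff_of_nonneg fun t _ => hq.1 s t).1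
      ((mul_eq_zero.1 h1).resolve_left (hμ s).ne')
  obtain ⟨s, hs⟩ := hC
  obtain ⟨t, ht⟩ := hC'
  have hpow : ∀ n : ℕ, ∀ t ∈ Cᶜ, (q ^ n) s t = 0 := by
    intro n
    induction n with
    | zero =>
      intro t ht
      rw [pow_zero, Matrix.one_apply_ne]
      rintro rfl
      exact Finset.mem_compl.1 ht hs
    | succ n ih =>
      intro t ht
      rw [pow_succ, Matrix.mul_apply]
      refine Finset.sum_eq_zero fun u _ => ?_
      by_cases hu : u ∈ C
      · rw [hzero u hu t ht, mul_zero]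
      · rw [ih u (Finset.mem_compl.2 hu), zero_mul]
  obtain ⟨n, -, hn⟩ := hirr s t
  exact hn.ne' (hpow n t ht)

lemma IsStationary.inflow_add {q : Matrix S S ℝ} {μ : S → ℝ} (hμ : IsStationary q μ)
    (C : Finset S) (v : S) :
    ∑ s ∈ C, μ s * q s v + ∑ s ∈ Cᶜ, μ s * q s v = μ v := by
  rw [Finset.sum_add_sum_compl, hμ.2.2 v]

/-- For a stationary chain the flow into a set equals the flow out of it. -/
lemma IsStationary.inflow_eq_outflow {q : Matrix S S ℝ} {μ : S → ℝ} (hq : IsTransition q)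
    (hμ : IsStationary q μ) (C : Finset S) :
    ∑ v ∈ C, ∑ s ∈ Cᶜ, μ s * q s v = ∑ s ∈ C, μ s * ∑ t ∈ Cᶜ, q s t := by
  have h1 : ∀ s, ∑ t ∈ Cᶜ, q s t = 1 - ∑ t ∈ C, q s t := fun s => by
    rw [← hq.2 s, ← Finset.sum_add_sum_compl C]; ring
  have h2 : ∀ v, ∑ s ∈ Cᶜ, μ s * q s v = μ v - ∑ s ∈ C, μ s * q s v := fun v => by
    rw [← hμ.inflow_add C v]; ring
  simp only [h1, h2, mul_sub, mul_one, Finset.sum_sub_distrib, Finset.mul_sum]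
  rw [Finset.sum_comm]

lemma tsum_spec_of_recursion {q : Matrix S S ℝ} (hq : IsTransition q) {C : Finset S} {t : S}
    (ht : t ∉ C) {b : ℕ → S → ℝ} (h0 : ∀ s ∈ C, b 0 s = q s t)
    (hsucc : ∀ n, ∀ s ∈ C, b (n + 1) s = ∑ v ∈ C, q s v * b n v) :
    ∀ s ∈ C, 0 ≤ ∑' n, b n s ∧ ∑' n, b n s ≤ 1 ∧
      ∑' n, b n s = q s t + ∑ v ∈ C, q s v * ∑' n, b n v := by
  have hnn : ∀ n, ∀ s ∈ C, 0 ≤ b n s := by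
    intro n
    induction n with
    | zero => exact fun s hs => (h0 s hs).symm ▸ hq.1 s t
    | succ n ih =>
      intro s hs
      rw [hsucc n s hs]
      exact Finset.sum_nonneg fun v hv => mul_nonneg (hq.1 s v) (ih v hv)
  have hrec : ∀ N, ∀ s ∈ C, ∑ n ∈ Finset.range (N + 1), b n s =
      q s t + ∑ v ∈ C, q s v * ∑ n ∈ Finset.range N, b n v := by
    intro N s hs
    rw [Finset.sum_range_succ', h0 s hs, add_comm,
      Finset.sum_congr rfl fun n _ => hsucc n s hs, Finset.sum_comm]
    simp only [Finset.mul_sum]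
  have hle : ∀ N, ∀ s ∈ C, ∑ n ∈ Finset.range N, b n s ≤ 1 := by
    intro N
    induction N with
    | zero => simp
    | succ N ih =>
      intro s hs
      rw [hrec N s hs]
      calc q s t + ∑ v ∈ C, q s v * ∑ n ∈ Finset.range N, b n v
          ≤ q s t + ∑ v ∈ C, q s v := by
            gcongr with v hv
            exact mul_le_of_le_one_right (hq.1 s v) (ih v hv)
        _ = ∑ v ∈ insert t C, q s v := (Finset.sum_insert ht).symm
        _ ≤ ∑ v, q s v := Finset.sum_le_univ_sum_of_nonneg (hq.1 s)
        _ = 1 := hq.2 s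
  have hsum : ∀ s ∈ C, Summable fun n => b n s := fun s hs =>
    summable_of_sum_range_le (fun n => hnn n s hs) fun N => hle N s hs
  intro s hs
  refine ⟨tsum_nonneg fun n => hnn n s hs,
    Real.tsum_le_of_sum_range_le (fun n => hnn n s hs) fun N => hle N s hs, ?_⟩
  rw [(hsum s hs).tsum_eq_zero_add, h0 s hs,
    tsum_congr fun n => hsucc n s hs,
    Summable.tsum_finsetSum fun v hv => (hsum v hv).mul_left _]
  simp only [tsum_mul_left]

lemma exitProb_spec {q : Matrix S S ℝ} (hq : IsTransition q) {C : Finset S} {t : S}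
    (ht : t ∉ C) : ∀ s ∈ C, 0 ≤ exitProb q C s t ∧ exitProb q C s t ≤ 1 ∧
      exitProb q C s t = q s t + ∑ v ∈ C, q s v * exitProb q C v t := by
  intro s hs
  refine tsum_spec_of_recursion hq ht
    (b := fun n s => ∑ u ∈ C, ((subMat q C ^ n : Matrix S S ℝ) s u) * q u t) ?_ ?_ s hs
  · intro s hs
    simp [Matrix.one_apply, hs]
  · intro n s hs
    have hmul : ∀ u, (subMat q C ^ (n + 1) : Matrix S S ℝ) s u =
        ∑ v ∈ C, q s v * (subMat q C ^ n : Matrix S S ℝ) v u := by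
      intro u
      simp [pow_succ', Matrix.mul_apply, subMat, hs, ite_mul, Finset.sum_ite_mem]
    simp only [hmul, Finset.sum_mul, Finset.mul_sum]
    rw [Finset.sum_comm]
    simp only [mul_assoc]

/-- Under the mixing hypothesis there is a `[0,1]`-valued function that vanishes off `S₁`, is at
least `a` off `t`, and is harmonic off `t` inside `S₁`: the probability of reaching `t` before
leaving `S₁`. -/
lemma Mixing.exists_hitting {q : Matrix S S ℝ} (hq : IsTransition q) {S1 : Finset S} {a : ℝ}
    (hmix : Mixing q S1 a) {t : S} (ht : t ∈ S1) :
    ∃ w : S → ℝ, (∀ s, 0 ≤ w s ∧ w s ≤ 1) ∧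
      ∀ s ∈ S1.erase t, a ≤ w s ∧ w s = ∑ v ∈ S1, q s v * w v := by
  have hspec := exitProb_spec hq (Finset.notMem_erase t S1)
  refine ⟨fun s => if s = t then 1 else if s ∈ S1 then exitProb q (S1.erase t) s t else 0, ?_, ?_⟩
  · intro s
    dsimp only
    split_ifs with h1 h2
    · simp
    · have := hspec s (Finset.mem_erase.2 ⟨h1, h2⟩)
      exact ⟨this.1, this.2.1⟩
    · simp
  · intro s hs
    have hs' := Finset.mem_erase.1 hs
    have heq : ∑ v ∈ S1, q s v *
        (if v = t then 1 else if v ∈ S1 then exitProb q (S1.erase t) v t else 0) =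
        q s t + ∑ v ∈ S1.erase t, q s v * exitProb q (S1.erase t) v t := by
      rw [← Finset.add_sum_erase S1 _ ht]
      congr 1
      · simp
      · refine Finset.sum_congr rfl fun v hv => ?_
        simp [(Finset.mem_erase.1 hv).1, (Finset.mem_erase.1 hv).2]
    simp only [heq, hs'.1, hs'.2, if_true, if_false]
    refine ⟨?_, (hspec s hs).2.2⟩
    rw [(hspec s hs).2.2]
    exact hmix s hs'.2 t ht

lemma Mixing.le_one {q : Matrix S S ℝ} (hq : IsTransition q) {S1 : Finset S} {a : ℝ}
    (hmix : Mixing q S1 a) (hS1 : 1 < S1.card) : a ≤ 1 := by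
  obtain ⟨s, hs, t, ht, hst⟩ := Finset.one_lt_card.1 hS1
  obtain ⟨w, hw, hw'⟩ := hmix.exists_hitting hq ht
  exact (hw' s (Finset.mem_erase.2 ⟨hst, hs⟩)).1.trans (hw s).2

/-- Under mixing, a fraction at least `a` of the outflow of `D ⊂ S₁` goes directly to `S₁ \ D`. -/
lemma Mixing.mul_outflow_le {q : Matrix S S ℝ} {μ : S → ℝ} (hq : IsTransition q)
    (hμ : IsStationary q μ) {S1 : Finset S} {a : ℝ} (hmix : Mixing q S1 a) {D : Finset S}
    (hD : D ⊂ S1) :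
    a * ∑ s ∈ D, μ s * ∑ t ∈ Dᶜ, q s t ≤ ∑ s ∈ D, μ s * ∑ t ∈ S1 \ D, q s t := by
  obtain ⟨t, ht, htD⟩ := Finset.exists_of_ssubset hD
  obtain ⟨w, hw, hw'⟩ := hmix.exists_hitting hq ht
  replace hw' : ∀ s ∈ D, a ≤ w s ∧ w s = ∑ v ∈ S1, q s v * w v := fun s hs =>
    hw' s (Finset.mem_erase.2 ⟨fun h => htD (h ▸ hs), hD.1 hs⟩)
  have hin : a * ∑ s ∈ D, μ s * ∑ t ∈ Dᶜ, q s t ≤ ∑ v ∈ D, (∑ s ∈ Dᶜ, μ s * q s v) * w v := by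
    rw [← hμ.inflow_eq_outflow hq D, Finset.mul_sum]
    refine Finset.sum_le_sum fun v hv => ?_
    rw [mul_comm]
    exact mul_le_mul_of_nonneg_left (hw' v hv).1
      (Finset.sum_nonneg fun s _ => mul_nonneg (hμ.1 s) (hq.1 s v))
  have hbal : ∑ v ∈ D, (∑ s ∈ Dᶜ, μ s * q s v) * w v =
      ∑ s ∈ D, μ s * ∑ v ∈ S1 \ D, q s v * w v := by
    have h1 : ∀ v, ∑ s ∈ Dᶜ, μ s * q s v = μ v - ∑ s ∈ D, μ s * q s v := fun v => by
      rw [← hμ.inflow_add D v]; ring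
    have h2 : ∀ s ∈ D, μ s * ∑ v ∈ S1 \ D, q s v * w v =
        μ s * w s - μ s * ∑ v ∈ D, q s v * w v := fun s hs => by
      rw [(hw' s hs).2, ← Finset.sum_sdiff hD.1]; ring
    rw [Finset.sum_congr rfl h2]
    simp only [h1, sub_mul, Finset.sum_sub_distrib, Finset.sum_mul, Finset.mul_sum]
    rw [Finset.sum_comm]
    simp only [mul_assoc]
  rw [hbal] at hin
  refine hin.trans (Finset.sum_le_sum fun s _ => mul_le_mul_of_nonneg_left ?_ (hμ.1 s))
  exact Finset.sum_le_sum fun v _ => mul_le_of_le_one_right (hq.1 s v) (hw v).2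

/-- The Dirichlet problem on the complement of `S₁` with boundary values `1` on `S₁ \ D` and `0`
on `D` has a `[0,1]`-valued solution. -/
lemma exists_harmonic {q : Matrix S S ℝ} (hq : IsTransition q) (S1 D : Finset S) :
    ∃ h : S → ℝ, (∀ s, 0 ≤ h s ∧ h s ≤ 1) ∧ (∀ s ∈ S1, h s = if s ∈ D then 0 else 1) ∧
      ∀ s ∉ S1, h s = ∑ t, q s t * h t := by
  let T : (S → ℝ) → S → ℝ := fun h s =>
    if s ∈ S1 then (if s ∈ D then 0 else 1) else ∑ t, q s t * h t
  let H : ℕ → S → ℝ := fun n => T^[n] 0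
  have hHs : ∀ n, H (n + 1) = T (H n) := fun n => Function.iterate_succ_apply' T n 0
  have hTmono : Monotone T := by
    intro f g hfg s
    simp only [T]
    split_ifs
    · exact le_rfl
    · exact le_rfl
    · exact Finset.sum_le_sum fun t _ => mul_le_mul_of_nonneg_left (hfg t) (hq.1 s t)
  have h01 : ∀ n, 0 ≤ H n ∧ H n ≤ 1 := by
    have hT0 : 0 ≤ T 0 := by
      intro s
      simp only [T]
      split_ifs <;> simp
    have hT1 : T 1 ≤ 1 := by
      intro s
      simp only [T]
      split_ifs <;> simp [hq.2 s]
    intro n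
    induction n with
    | zero => exact ⟨le_rfl, zero_le_one⟩
    | succ n ih =>
      rw [hHs]
      exact ⟨hT0.trans (hTmono ih.1), (hTmono ih.2).trans hT1⟩
  have hmono : Monotone H := by
    refine monotone_nat_of_le_succ fun n => ?_
    induction n with
    | zero => exact (h01 1).1
    | succ n ih =>
      rw [hHs n, hHs (n + 1)]
      exact hTmono ih
  have hlim : ∀ s, Filter.Tendsto (fun n => H n s) Filter.atTop (nhds (⨆ n, H n s)) := fun s =>
    tendsto_atTop_ciSup (fun m n hmn => hmono hmn s)
      ⟨1, by rintro _ ⟨n, rfl⟩; exact (h01 n).2 s⟩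
  have hfix : ∀ s, (⨆ n, H n s) = T (fun s => ⨆ n, H n s) s := by
    intro s
    refine tendsto_nhds_unique ((Filter.tendsto_add_atTop_iff_nat 1).2 (hlim s)) ?_
    simp only [hHs, T]
    split_ifs
    · exact tendsto_const_nhds
    · exact tendsto_const_nhds
    · exact tendsto_finsetSum _ fun t _ => (hlim t).const_mul _
  refine ⟨fun s => ⨆ n, H n s, fun s => ⟨?_, ?_⟩, fun s hs => ?_, fun s hs => ?_⟩
  · exact ge_of_tendsto' (hlim s) fun n => (h01 n).1 s
  · exact le_of_tendsto' (hlim s) fun n => (h01 n).2 s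
  · exact (hfix s).trans (if_pos hs)
  · exact (hfix s).trans (if_neg hs)

/-- For `h` harmonic off `S₁`, with values `0` on `D` and `1` on `S₁ \ D`, the stationary flows
from `D` and into `D` through `S \ S₁` balance. -/
lemma IsStationary.harmonic_balance {q : Matrix S S ℝ} {μ h : S → ℝ} (hq : IsTransition q)
    (hμ : IsStationary q μ) {S1 D : Finset S} (hD : D ⊆ S1)
    (hb : ∀ s ∈ S1, h s = if s ∈ D then 0 else 1) (hh : ∀ s ∉ S1, h s = ∑ t, q s t * h t) :
    ∑ s ∈ D, μ s * ∑ t, q s t * h t = ∑ s ∈ S1 \ D, μ s * ∑ t, q s t * (1 - h t) := by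
  have h0 : ∑ s, μ s * (∑ t, q s t * h t - h s) = 0 := by
    simp only [mul_sub, Finset.sum_sub_distrib, Finset.mul_sum]
    rw [Finset.sum_comm]
    simp only [← mul_assoc, ← Finset.sum_mul, hμ.2.2, sub_self]
  rw [← Finset.sum_subset (Finset.subset_univ S1) (fun s _ hs => by rw [← hh s hs]; simp),
    ← Finset.sum_sdiff hD] at h0
  have h1 : ∑ s ∈ D, μ s * (∑ t, q s t * h t - h s) = ∑ s ∈ D, μ s * ∑ t, q s t * h t :=
    Finset.sum_congr rfl fun s hs => by rw [hb s (hD hs), if_pos hs, sub_zero]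
  have h2 : ∑ s ∈ S1 \ D, μ s * (∑ t, q s t * h t - h s) =
      -∑ s ∈ S1 \ D, μ s * ∑ t, q s t * (1 - h t) := by
    rw [← Finset.sum_neg_distrib]
    refine Finset.sum_congr rfl fun s hs => ?_
    have hs' := Finset.mem_sdiff.1 hs
    rw [hb s hs'.1, if_neg hs'.2]
    simp only [mul_sub, mul_one, Finset.sum_sub_distrib, hq.2 s]
    ring
  linarith

lemma IsClose.abs_flow_sub_le {q qh : Matrix S S ℝ} {μ : S → ℝ} {z ε β : ℝ}
    (hq : IsTransition q) (hqh : IsTransition qh) (hμ : ∀ s, 0 ≤ μ s) (hz : 0 ≤ ε * z)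
    (hβ : 0 ≤ β) (hclose : IsClose q qh μ z ε β) (E : Finset S) {w : S → ℝ}
    (hw : ∀ s, 0 ≤ w s ∧ w s ≤ 1) :
    |∑ s ∈ E, μ s * ∑ t, qh s t * w t - ∑ s ∈ E, μ s * ∑ t, q s t * w t| ≤
      β * (∑ s ∈ E, μ s * ∑ t, q s t * w t) + (Fintype.card S : ℝ) ^ 2 * (ε * z) := by
  have hpt : ∀ s t, |μ s * qh s t * w t - μ s * q s t * w t| ≤
      β * (μ s * q s t * w t) + ε * z := by
    intro s t
    have h1 : |μ s * qh s t - μ s * q s t| ≤ β * (μ s * q s t) + ε * z := by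
      have hq0 := mul_nonneg (hμ s) (hq.1 s t)
      have hqh0 := mul_nonneg (hμ s) (hqh.1 s t)
      by_cases hc : ε * z ≤ μ s * q s t ∨ ε * z ≤ μ s * qh s t
      · have h := mul_le_mul_of_nonneg_left (hclose s t hc) (hμ s)
        rw [← mul_sub, abs_mul, abs_of_nonneg (hμ s)]
        linarith
      · push Not at hc
        have := mul_nonneg hβ hq0
        rw [abs_le]
        constructor <;> linarith
    rw [← sub_mul, abs_mul, abs_of_nonneg (hw t).1]
    calc |μ s * qh s t - μ s * q s t| * w t ≤ (β * (μ s * q s t) + ε * z) * w t :=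
          mul_le_mul_of_nonneg_right h1 (hw t).1
      _ = β * (μ s * q s t * w t) + ε * z * w t := by ring
      _ ≤ _ := add_le_add_right (mul_le_of_le_one_right hz (hw t).2) _
  simp only [Finset.mul_sum, ← Finset.sum_sub_distrib, ← mul_assoc]
  calc |∑ s ∈ E, ∑ t, (μ s * qh s t * w t - μ s * q s t * w t)|
      ≤ ∑ s ∈ E, ∑ t, |μ s * qh s t * w t - μ s * q s t * w t| :=
        (Finset.abs_sum_le_sum_abs _ _).trans
          (Finset.sum_le_sum fun s _ => Finset.abs_sum_le_sum_abs _ _)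
    _ ≤ ∑ s ∈ E, ∑ t, (β * (μ s * q s t * w t) + ε * z) :=
        Finset.sum_le_sum fun s _ => Finset.sum_le_sum fun t _ => hpt s t
    _ = ∑ s ∈ E, ∑ t, β * μ s * q s t * w t + (E.card : ℝ) * (Fintype.card S * (ε * z)) := by
        simp only [Finset.sum_add_distrib, Finset.sum_const, nsmul_eq_mul, Finset.card_univ,
          mul_assoc]
    _ ≤ _ := by
        have : (E.card : ℝ) ≤ Fintype.card S := by exact_mod_cast Finset.card_le_univ E
        rw [sq, mul_assoc]
        simp only [mul_assoc]
        exact add_le_add_right (mul_le_mul_of_nonneg_right this (by positivity)) _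

/-- If every nonempty proper subset `D` of `A` contains an element whose value is at most `r` times
the value at some element of `A \ D`, then values on `A` differ at most by a power of `r`. -/
lemma le_pow_mul_of_forall_ssubset {α : Type*} [DecidableEq α] {A : Finset α} {x : α → ℝ} {r : ℝ} (hr : 1 ≤ r)
    (hx : ∀ s ∈ A, 0 ≤ x s)
    (h : ∀ D, D.Nonempty → D ⊂ A → ∃ s ∈ D, ∃ t ∈ A \ D, x s ≤ r * x t) {v : α}
    (hv : v ∈ A) :
    ∀ u ∈ A, x u ≤ r ^ (A.card - 1) * x v := by
  have hr0 : 0 ≤ r := zero_le_one.trans hr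
  let E : ℕ → Finset α := fun k => {t ∈ A | x t ≤ r ^ k * x v}
  have hEA : ∀ k, E k ⊆ A := fun k => Finset.filter_subset _ _
  have hEs : ∀ k, E k ⊆ E (k + 1) := by
    intro k t ht
    obtain ⟨htA, ht⟩ := Finset.mem_filter.1 ht
    refine Finset.mem_filter.2 ⟨htA, ht.trans ?_⟩
    exact mul_le_mul_of_nonneg_right (pow_le_pow_right₀ hr k.le_succ) (hx v hv)
  have hvE : ∀ k, v ∈ E k := fun k =>
    Finset.mem_filter.2 ⟨hv, le_mul_of_one_le_left (hx v hv) (one_le_pow₀ hr)⟩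
  have hcard : ∀ k, E k = A ∨ k + 1 ≤ (E k).card := by
    intro k
    induction k with
    | zero => exact Or.inr (Finset.card_pos.2 ⟨v, hvE 0⟩)
    | succ k ih =>
      by_cases hk : E k = A
      · exact Or.inl ((hEA _).antisymm (hk ▸ hEs k))
      · obtain ⟨s, hs, t, ht, hst⟩ := h (A \ E k)
          (Finset.sdiff_nonempty.2 fun hle => hk ((hEA k).antisymm hle))
          (Finset.sdiff_ssubset (hEA k) ⟨v, hvE k⟩)
        have htE : t ∈ E k := by
          rw [Finset.sdiff_sdiff_eq_self (hEA k)] at ht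
          exact ht
        obtain ⟨hsA, hsE⟩ := Finset.mem_sdiff.1 hs
        have hsE' : s ∈ E (k + 1) := by
          refine Finset.mem_filter.2 ⟨hsA, hst.trans ?_⟩
          rw [pow_succ', mul_assoc]
          exact mul_le_mul_of_nonneg_left (Finset.mem_filter.1 htE).2 hr0
        have := Finset.card_lt_card
          (Finset.ssubset_iff_of_subset (hEs k) |>.2 ⟨s, hsE', hsE⟩)
        exact Or.inr ((Nat.succ_le_succ (ih.resolve_left hk)).trans this)
  have hfin : E (A.card - 1) = A := by
    refine (hcard _).elim id fun hle => Finset.eq_of_subset_of_card_le (hEA _) ?_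
    have := Finset.card_pos.2 ⟨v, hv⟩
    omega
  intro u hu
  rw [← hfin] at hu
  exact (Finset.mem_filter.1 hu).2

lemma one_le_Lconst {α : Type*} [Fintype α] (hcard : 2 ≤ Fintype.card α) : 1 ≤ Lconst α := by
  refine le_trans ?_ (Finset.single_le_sum (fun _ _ => Nat.zero_le _)
    (Finset.mem_Ico.2 ⟨le_rfl, hcard⟩ : 1 ∈ Finset.Ico 1 (Fintype.card α)))
  simp only [Nat.choose_one_right, one_pow, mul_one]
  omega

lemma card_sq_mul_le {n : ℕ} {L a β ε : ℝ} (hn : 2 ≤ n) (hL : 1 ≤ L) (ha : 0 < a) (ha1 : a ≤ 1)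
    (hβ0 : 0 < β) (hβ1 : β ≤ 1)
    (hε : ε < 1 / 2 * (a / L) ^ n * (β * (1 - β) / (L * (n : ℝ) ^ 4))) :
    (n : ℝ) ^ 2 * ε ≤ a * β / 4 := by
  have hn' : (2 : ℝ) ≤ n := by exact_mod_cast hn
  have h1 : (a / L) ^ n ≤ a := by
    have haL : a / L ≤ a := div_le_self ha.le hL
    exact (pow_le_of_le_one (by positivity) (haL.trans ha1) (by omega)).trans haL
  have h2 : β * (1 - β) / (L * (n : ℝ) ^ 4) ≤ β / (n : ℝ) ^ 4 := by
    gcongr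
    · nlinarith
    · exact le_mul_of_one_le_left (by positivity) hL
  have h3 : 1 / 2 * (a / L) ^ n * (β * (1 - β) / (L * (n : ℝ) ^ 4)) ≤
      1 / 2 * a * (β / (n : ℝ) ^ 4) := by
    gcongr
  calc (n : ℝ) ^ 2 * ε ≤ (n : ℝ) ^ 2 * (1 / 2 * a * (β / (n : ℝ) ^ 4)) := by
        gcongr; exact hε.le.trans h3
    _ = a * β / (2 * (n : ℝ) ^ 2) := by field_simp
    _ ≤ a * β / 4 := by
        gcongr
        nlinarith

lemma four_mul_pred_le_two_pow {n : ℕ} (hn : 2 ≤ n) : 4 * (n - 1) ≤ 2 ^ n := by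
  induction n, hn using Nat.le_induction with
  | base => norm_num
  | succ k hk ih =>
    have : 2 ^ 2 ≤ 2 ^ k := Nat.pow_le_pow_right two_pos hk
    rw [pow_succ]
    omega

lemma ratio_pow_le_three {n : ℕ} (hn : 2 ≤ n) {β : ℝ} (hβ0 : 0 ≤ β) (hβ : β < 1 / 2 ^ n) {m : ℕ}
    (hm : m ≤ n - 1) : ((1 + 5 / 4 * β) / (1 - 5 / 4 * β)) ^ m ≤ 3 := by
  have h2n : (4 : ℝ) ≤ 2 ^ n := by
    calc (4 : ℝ) = 2 ^ 2 := by norm_num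
      _ ≤ 2 ^ n := pow_le_pow_right₀ (by norm_num) hn
  have hβ4 : β ≤ 1 / 4 := hβ.le.trans (one_div_le_one_div_of_le (by norm_num) h2n)
  have hβn : β * 2 ^ n ≤ 1 := ((lt_div_iff₀ (by positivity)).1 hβ).le
  have hmn : 4 * (m : ℝ) ≤ 2 ^ n := by
    exact_mod_cast (Nat.mul_le_mul_left 4 hm).trans (four_mul_pred_le_two_pow hn)
  have hr : (1 + 5 / 4 * β) / (1 - 5 / 4 * β) ≤ Real.exp (4 * β) := by
    refine le_trans ?_ (Real.add_one_le_exp _)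
    rw [div_le_iff₀ (by linarith)]
    nlinarith
  calc ((1 + 5 / 4 * β) / (1 - 5 / 4 * β)) ^ m ≤ Real.exp (4 * β) ^ m := by
        gcongr
        exact div_nonneg (by linarith) (by linarith)
    _ = Real.exp (m * (4 * β)) := (Real.exp_nat_mul _ _).symm
    _ ≤ Real.exp 1 := by
        gcongr
        nlinarith
    _ ≤ 3 := Real.exp_one_lt_d9.le.trans (by norm_num)

/-- for nonempty proper `C ⊂ S₁`, the average lengths of visits to `C` satisfy
`K_C/(2|S|²) ≤ K̂_C ≤ 2|S|²·K_C`. -/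
theorem perturbed_visit_length_close_on_subset
    (hcard : 2 ≤ Fintype.card S)
    (q qh : Matrix S S ℝ) (μ : S → ℝ) (S1 : Finset S) (hS1 : 1 < S1.card)
    (β ε a : ℝ)
    (hβ0 : 0 < β) (hβ1 : β < 1 / 2 ^ Fintype.card S) (ha : 0 < a)
    (hε0 : 0 < ε)
    (hε1 : ε < 1 / 2 * (a / (Lconst S : ℝ)) ^ Fintype.card S *
        (β * (1 - β) / ((Lconst S : ℝ) * (Fintype.card S : ℝ) ^ 4)))
    (hq : IsTransition q) (hqirr : IsIrreducible q) (hμ : IsStationary q μ)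
    (hmix : Mixing q S1 a)
    (hqh : IsTransition qh)
    (hclose : IsClose q qh μ (zeta1 q μ S1) ε β)
    (hcoin : ∀ s ∉ S1, ∀ t, qh s t = q s t)
    (R : Finset S) (hR : IsRecClass qh R) (hS1R : S1 ⊆ R)
    (μh : S → ℝ) (hμh : IsStationary qh μh) (hsupp : ∀ s ∉ R, μh s = 0) :
    ∀ C : Finset S, C.Nonempty → C ⊂ S1 →
      ((∑ s ∈ C, μ s) / (∑ s ∈ C, μ s * ∑ t ∈ Cᶜ, q s t)) / (2 * (Fintype.card S : ℝ) ^ 2)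
          ≤ (∑ s ∈ C, μh s) / (∑ s ∈ C, μh s * ∑ t ∈ Cᶜ, qh s t) ∧
        (∑ s ∈ C, μh s) / (∑ s ∈ C, μh s * ∑ t ∈ Cᶜ, qh s t)
          ≤ 2 * (Fintype.card S : ℝ) ^ 2 *
              ((∑ s ∈ C, μ s) / (∑ s ∈ C, μ s * ∑ t ∈ Cᶜ, q s t)) := by
  classical
  have hμpos : ∀ s, 0 < μ s := fun s =>
    hμ.pos_of_reachable hq (R := Finset.univ) (by simp) (fun s _ t _ => hqirr s t)
      (Finset.mem_univ s)
  have hμhpos : ∀ s ∈ S1, 0 < μh s := fun s hs =>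
    hμh.pos_of_reachable hqh hsupp hR.2 (hS1R hs)
  have ha1 : a ≤ 1 := hmix.le_one hq hS1
  have hn : (2 : ℝ) ≤ Fintype.card S := by exact_mod_cast hcard
  have h2n : (4 : ℝ) ≤ 2 ^ Fintype.card S := by
    calc (4 : ℝ) = 2 ^ 2 := by norm_num
      _ ≤ 2 ^ Fintype.card S := pow_le_pow_right₀ (by norm_num) hcard
  have hβ4 : β ≤ 1 / 4 := hβ1.le.trans (one_div_le_one_div_of_le (by norm_num) h2n)
  have hε : (Fintype.card S : ℝ) ^ 2 * ε ≤ a * β / 4 :=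
    card_sq_mul_le hcard (by exact_mod_cast one_le_Lconst hcard) ha ha1 hβ0 (by linarith) hε1
  have hflow_nonneg : ∀ D : Finset S, 0 ≤ ∑ s ∈ D, μ s * ∑ t ∈ Dᶜ, q s t := fun D =>
    Finset.sum_nonneg fun s _ => mul_nonneg (hμ.1 s) (Finset.sum_nonneg fun t _ => hq.1 s t)
  have hflow_pos : ∀ D : Finset S, D.Nonempty → D ⊂ S1 →
      0 < ∑ s ∈ D, μ s * ∑ t ∈ Dᶜ, q s t := fun D hD hDS => by
    obtain ⟨t, -, ht⟩ := Finset.exists_of_ssubset hDS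
    exact outflow_pos hq hqirr hμpos hD ⟨t, Finset.mem_compl.2 ht⟩
  have hz0 : 0 ≤ zeta1 q μ S1 := Real.sInf_nonneg (by
    rintro _ ⟨D, -, -, rfl⟩
    exact hflow_nonneg D)
  have hzle : ∀ D : Finset S, D.Nonempty → D ⊂ S1 →
      zeta1 q μ S1 ≤ ∑ s ∈ D, μ s * ∑ t ∈ Dᶜ, q s t := fun D hD hDS =>
    csInf_le ⟨0, by rintro _ ⟨D, -, -, rfl⟩; exact hflow_nonneg D⟩ ⟨D, hD, hDS, rfl⟩
  have hεz : 0 ≤ ε * zeta1 q μ S1 := mul_nonneg hε0.le hz0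
  -- a flow dominating `a · ζ_q^1` is perturbed by a factor at most `1 ± 5β/4`
  have hpert : ∀ (E : Finset S) (w : S → ℝ), (∀ s, 0 ≤ w s ∧ w s ≤ 1) →
      a * zeta1 q μ S1 ≤ ∑ s ∈ E, μ s * ∑ t, q s t * w t →
      |∑ s ∈ E, μ s * ∑ t, qh s t * w t - ∑ s ∈ E, μ s * ∑ t, q s t * w t| ≤
        5 / 4 * β * ∑ s ∈ E, μ s * ∑ t, q s t * w t := by
    intro E w hw hle
    refine (hclose.abs_flow_sub_le hq hqh hμ.1 hεz hβ0.le E hw).trans ?_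
    have h1 := mul_le_mul_of_nonneg_right hε hz0
    have h2 := mul_le_mul_of_nonneg_left hle hβ0.le
    linarith
  set r : ℝ := (1 + 5 / 4 * β) / (1 - 5 / 4 * β) with hr
  have hden : 0 < 1 - 5 / 4 * β := by linarith
  have hr1 : 1 ≤ r := by
    rw [hr, one_le_div hden]
    linarith
  let x : S → ℝ := fun s => μh s / μ s
  have hx : ∀ s, x s * μ s = μh s := fun s => div_mul_cancel₀ _ (hμpos s).ne'
  have hxpos : ∀ s ∈ S1, 0 < x s := fun s hs => div_pos (hμhpos s hs) (hμpos s)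
  have hcut : ∀ D : Finset S, D.Nonempty → D ⊂ S1 →
      ∃ s ∈ D, ∃ t ∈ S1 \ D, x s ≤ r * x t := by
    intro D hD hDS
    obtain ⟨h, h01, hb, hh⟩ := exists_harmonic hq S1 D
    have hhh : ∀ s ∉ S1, h s = ∑ t, qh s t * h t := fun s hs => by
      simp only [hcoin s hs]
      exact hh s hs
    have hbal := hμ.harmonic_balance hq hDS.1 hb hh
    have hbalh := hμh.harmonic_balance hqh hDS.1 hb hhh
    have hA : a * ∑ s ∈ D, μ s * ∑ t ∈ Dᶜ, q s t ≤ ∑ s ∈ D, μ s * ∑ t, q s t * h t := by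
      refine (hmix.mul_outflow_le hq hμ hDS).trans
        (Finset.sum_le_sum fun s _ => mul_le_mul_of_nonneg_left ?_ (hμ.1 s))
      calc ∑ t ∈ S1 \ D, q s t = ∑ t ∈ S1 \ D, q s t * h t :=
            Finset.sum_congr rfl fun t ht => by
              have ht' := Finset.mem_sdiff.1 ht
              rw [hb t ht'.1, if_neg ht'.2, mul_one]
        _ ≤ _ := Finset.sum_le_univ_sum_of_nonneg fun t => mul_nonneg (hq.1 s t) (h01 t).1
    have hApos := (mul_pos ha (hflow_pos D hD hDS)).trans_le hA
    have hAz := (mul_le_mul_of_nonneg_left (hzle D hD hDS) ha.le).trans hA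
    have hpA := (abs_le.1 (hpert D h h01 hAz)).1
    have hpB := (abs_le.1 (hpert (S1 \ D) (fun t => 1 - h t)
      (fun t => ⟨by linarith [(h01 t).2], by linarith [(h01 t).1]⟩) (hbal ▸ hAz))).2
    rw [← hbal] at hpB
    obtain ⟨s, hs, hsmin⟩ := Finset.exists_min_image D x hD
    obtain ⟨t, ht, htmax⟩ := Finset.exists_max_image (S1 \ D) x
      (Finset.sdiff_nonempty.2 hDS.2)
    refine ⟨s, hs, t, ht, ?_⟩
    have hlo : x s * ∑ s ∈ D, μ s * ∑ t, qh s t * h t ≤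
        ∑ s ∈ D, μh s * ∑ t, qh s t * h t := by
      rw [Finset.mul_sum]
      refine Finset.sum_le_sum fun u hu => ?_
      rw [← hx u, mul_assoc]
      exact mul_le_mul_of_nonneg_right (hsmin u hu) (mul_nonneg (hμ.1 u)
        (Finset.sum_nonneg fun v _ => mul_nonneg (hqh.1 u v) (h01 v).1))
    have hhi : ∑ s ∈ S1 \ D, μh s * ∑ t, qh s t * (1 - h t) ≤
        x t * ∑ s ∈ S1 \ D, μ s * ∑ t, qh s t * (1 - h t) := by
      rw [Finset.mul_sum]
      refine Finset.sum_le_sum fun u hu => ?_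
      rw [← hx u, mul_assoc]
      exact mul_le_mul_of_nonneg_right (htmax u hu) (mul_nonneg (hμ.1 u)
        (Finset.sum_nonneg fun v _ => mul_nonneg (hqh.1 u v) (by linarith [(h01 v).2])))
    rw [hbalh] at hlo
    have hxs := hxpos s (hDS.1 hs)
    have hxt := hxpos t (Finset.mem_sdiff.1 ht).1
    set A := ∑ s ∈ D, μ s * ∑ t, q s t * h t
    have hchain : x s * ((1 - 5 / 4 * β) * A) ≤ x t * ((1 + 5 / 4 * β) * A) :=
      calc x s * ((1 - 5 / 4 * β) * A) ≤ _ := mul_le_mul_of_nonneg_left (by linarith) hxs.le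
        _ ≤ _ := hlo.trans hhi
        _ ≤ _ := mul_le_mul_of_nonneg_left (by linarith) hxt.le
    rw [hr, div_mul_eq_mul_div, le_div_iff₀ hden]
    refine le_of_mul_le_mul_right ?_ hApos
    linarith
  have hratio : ∀ u ∈ S1, ∀ v ∈ S1, x u ≤ 3 * x v := fun u hu v hv =>
    (le_pow_mul_of_forall_ssubset hr1 (fun s hs => (hxpos s hs).le) hcut hv u hu).trans
      (mul_le_mul_of_nonneg_right (ratio_pow_le_three hcard hβ0.le hβ1
        (Nat.sub_le_sub_right (Finset.card_le_univ S1) 1)) (hxpos v hv).le)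
  intro C hC hCS
  have hF := hflow_pos C hC hCS
  have hpC := hpert C (fun t => if t ∈ Cᶜ then 1 else 0)
    (fun t => by split_ifs <;> simp)
  simp only [mul_ite, mul_one, mul_zero, Finset.sum_ite_mem, Finset.univ_inter] at hpC
  obtain ⟨hp1, hp2⟩ := abs_le.1 (hpC ((mul_le_of_le_one_left hz0 ha1).trans (hzle C hC hCS)))
  obtain ⟨v, hv, hvmin⟩ := Finset.exists_min_image C x hC
  have hxv := hxpos v (hCS.1 hv)
  have hcomp : ∀ y : S → ℝ, (∀ s, 0 ≤ y s) →
      x v * ∑ s ∈ C, μ s * y s ≤ ∑ s ∈ C, μh s * y s ∧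
      ∑ s ∈ C, μh s * y s ≤ 3 * x v * ∑ s ∈ C, μ s * y s := by
    intro y hy
    simp only [Finset.mul_sum]
    constructor <;> refine Finset.sum_le_sum fun s hs => ?_ <;> rw [← hx s, mul_assoc]
    · exact mul_le_mul_of_nonneg_right (hvmin s hs) (mul_nonneg (hμ.1 s) (hy s))
    · exact mul_le_mul_of_nonneg_right (hratio s (hCS.1 hs) v (hCS.1 hv))
        (mul_nonneg (hμ.1 s) (hy s))
  obtain ⟨hM1, hM2⟩ := hcomp 1 fun _ => zero_le_one
  simp only [Pi.one_apply, mul_one] at hM1 hM2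
  obtain ⟨hF1, hF2⟩ := hcomp (fun s => ∑ t ∈ Cᶜ, qh s t)
    fun s => Finset.sum_nonneg fun t _ => hqh.1 s t
  have hMpos : 0 < ∑ s ∈ C, μ s := Finset.sum_pos (fun s _ => hμpos s) hC
  set M := ∑ s ∈ C, μ s
  set F := ∑ s ∈ C, μ s * ∑ t ∈ Cᶜ, q s t
  set Fm := ∑ s ∈ C, μ s * ∑ t ∈ Cᶜ, qh s t
  set Mh := ∑ s ∈ C, μh s
  set Fh := ∑ s ∈ C, μh s * ∑ t ∈ Cᶜ, qh s t
  have hβF : β * F ≤ 1 / 4 * F := mul_le_mul_of_nonneg_right hβ4 hF.le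
  have hFm1 : 1 / 2 * F ≤ Fm := by linarith
  have hFm2 : Fm ≤ 4 / 3 * F := by linarith
  have hFh1 : x v * (1 / 2 * F) ≤ Fh := (mul_le_mul_of_nonneg_left hFm1 hxv.le).trans hF1
  have hFh2 : Fh ≤ 3 * x v * (4 / 3 * F) :=
    hF2.trans (mul_le_mul_of_nonneg_left hFm2 (by positivity))
  have hMh : 0 ≤ Mh := (by positivity : 0 ≤ x v * M).trans hM1
  have hFh : 0 < Fh := (by positivity : 0 < x v * (1 / 2 * F)).trans_le hFh1
  have hK8 : (8 : ℝ) ≤ 2 * (Fintype.card S : ℝ) ^ 2 := by nlinarith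
  constructor
  · calc M / F / (2 * (Fintype.card S : ℝ) ^ 2) ≤ M / F / 8 := by gcongr
      _ ≤ x v * M / (3 * x v * (4 / 3 * F)) := by
        rw [div_div, div_le_div_iff₀ (by positivity) (by positivity)]
        have : 0 < M * F * x v := by positivity
        linarith
      _ ≤ Mh / Fh := by gcongr
  · calc Mh / Fh ≤ 3 * x v * M / (x v * (1 / 2 * F)) := by gcongr
      _ = 6 * (M / F) := by field_simp; norm_num
      _ ≤ 2 * (Fintype.card S : ℝ) ^ 2 * (M / F) := by gcongr; linarith

end PerturbedMC
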